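/- For all integers k, ℓ and every real R > 1, one has the decomposition E_{k,ℓ} = C̃(k,ℓ) + S̃_R(k,ℓ). (This is the identity expressing the whole-plane gas-phase inverse Kasteleyn kernel as the sum of a one-dimensional contour integral term and the solid-phase coupling term.) -/

import Mathlib

/-- `c = a/(1+a²)`. -/
noncomputable def cOf (a : ℝ) : ℝ := a / (1 + a ^ 2)

/-- The branch of the logarithm with argument in `(-π/2, 3π/2]`:
`L(z) = Log(-iz) + iπ/2` where `Log` is the principal branch. -/
noncomputable def Lbr (z : ℂ) : ℂ :=
  Complex.log (-Complex.I * z) + Complex.I * ((Real.pi : ℂ) / 2)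

/-- The branch `√(ω² + 2c) = exp((1/2)L(ω + i√(2c)) + (1/2)L(ω - i√(2c)))`. -/
noncomputable def sqBr (a : ℝ) (ω : ℂ) : ℂ :=
  Complex.exp ((1 / 2 : ℂ) * Lbr (ω + Complex.I * (Real.sqrt (2 * cOf a) : ℂ)) +
    (1 / 2 : ℂ) * Lbr (ω - Complex.I * (Real.sqrt (2 * cOf a) : ℂ)))

/-- `G(ω) = (ω - √(ω² + 2c))/√(2c)`. -/
noncomputable def Gbr (a : ℝ) (ω : ℂ) : ℂ :=
  (ω - sqBr a ω) / (Real.sqrt (2 * cOf a) : ℂ)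

/-- The branch cuts `𝒞 = i·((-∞, -1/√(2c)] ∪ [-√(2c), √(2c)] ∪ [1/√(2c), ∞))`. -/
def cuts (a : ℝ) : Set ℂ :=
  {z : ℂ | ∃ t : ℝ, z = Complex.I * (t : ℂ) ∧
    (t ≤ -(1 / Real.sqrt (2 * cOf a)) ∨
      (-Real.sqrt (2 * cOf a) ≤ t ∧ t ≤ Real.sqrt (2 * cOf a)) ∨
      1 / Real.sqrt (2 * cOf a) ≤ t)}

/-- `č(u,v) = 2(1+a²) + a(u + 1/u)(v + 1/v)`. -/
noncomputable def ccheck (a : ℝ) (u v : ℂ) : ℂ :=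
  2 * (1 + (a : ℂ) ^ 2) + (a : ℂ) * (u + u⁻¹) * (v + v⁻¹)

/-- The double contour integral
`E_{k,ℓ} = (2πi)⁻² ∮_{|u₁|=1} ∮_{|u₂|=1} u₁^ℓ u₂^k / (č(u₁,u₂)·u₁·u₂) du₂ du₁`. -/
noncomputable def EE (a : ℝ) (k l : ℤ) : ℂ :=
  ((2 * (Real.pi : ℂ) * Complex.I) ^ 2)⁻¹ *
    ∮ u₁ in C(0, 1), ∮ u₂ in C(0, 1), u₁ ^ l * u₂ ^ k / (ccheck a u₁ u₂ * u₁ * u₂)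

/-- `C̃(k,ℓ)`, the single contour integral over the unit circle. -/
noncomputable def Ctilde (a : ℝ) (k l : ℤ) : ℂ :=
  Complex.I ^ (-k - l) * (2 * (1 + (a : ℂ) ^ 2))⁻¹ * (2 * (Real.pi : ℂ) * Complex.I)⁻¹ *
    ∮ ω in C(0, 1), Gbr a ω ^ l * Gbr a ω⁻¹ ^ k / (ω * sqBr a ω * sqBr a ω⁻¹)

/-- `S̃_R(k,ℓ)`, the double contour integral over `|ω₁| = |ω₂| = R`. -/
noncomputable def Stilde (a R : ℝ) (k l : ℤ) : ℂ :=
  Complex.I ^ (-k - l) * (2 * (1 + (a : ℂ) ^ 2))⁻¹ *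
    ((2 * (Real.pi : ℂ) * Complex.I) ^ 2)⁻¹ *
    ∮ ω₁ in C(0, R), ∮ ω₂ in C(0, R),
      Gbr a ω₁ ^ l * Gbr a ω₂ ^ k / ((1 - ω₁ * ω₂) * sqBr a ω₁ * sqBr a ω₂)

open Set Metric Filter Topology

/-- The half-length `√(2c)` of the branch cut of `sqBr a`. -/
noncomputable abbrev cutRadius (a : ℝ) : ℝ := Real.sqrt (2 * cOf a)

lemma cutRadius_pos {a : ℝ} (ha0 : 0 < a) : 0 < cutRadius a := by
  have : 0 < cOf a := by unfold cOf; positivity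
  exact Real.sqrt_pos.2 (by positivity)

lemma cutRadius_lt_one {a : ℝ} (ha1 : a < 1) : cutRadius a < 1 := by
  rw [cutRadius, Real.sqrt_lt' one_pos, cOf, ← mul_div_assoc, div_lt_iff₀ (by positivity)]
  nlinarith [mul_pos (sub_pos.2 ha1) (sub_pos.2 ha1)]

lemma cutRadius_sq {a : ℝ} (ha0 : 0 < a) : (cutRadius a : ℂ) ^ 2 = 2 * (a / (1 + (a : ℂ) ^ 2)) := by
  have h : 0 < cOf a := by unfold cOf; positivity
  rw [← Complex.ofReal_pow, cutRadius, Real.sq_sqrt (by positivity), cOf]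
  push_cast
  rfl

lemma one_add_re_pos_of_norm_lt {w : ℂ} (hw : ‖w‖ < 1) : 0 < (1 + w).re := by
  have := (abs_le.1 (Complex.abs_re_le_norm w)).1
  simp only [Complex.add_re, Complex.one_re]
  linarith

/-- Translating by a real number smaller than `‖z‖` does not cross the cut of the logarithm. -/
lemma log_add_ofReal {z : ℂ} {s : ℝ} (h : |s| < ‖z‖) :
    Complex.log (z + s) = Complex.log z + Complex.log (1 + s / z) := by
  have hz : z ≠ 0 := norm_pos_iff.1 ((abs_nonneg s).trans_lt h)
  have hw : ‖(s : ℂ) / z‖ < 1 := by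
    rw [norm_div, Complex.norm_real, Real.norm_eq_abs]
    exact (div_lt_one (norm_pos_iff.2 hz)).2 h
  have hre := one_add_re_pos_of_norm_lt hw
  have hne : 1 + (s : ℂ) / z ≠ 0 := fun h0 => by simp [h0] at hre
  have hmul : z * (1 + s / z) = z + s := by field_simp
  have hzs : z + s ≠ 0 := hmul ▸ mul_ne_zero hz hne
  have hexp : Complex.exp (Complex.log (z + s)) =
      Complex.exp (Complex.log z + Complex.log (1 + s / z)) := by
    rw [Complex.exp_add, Complex.exp_log hz, Complex.exp_log hne, Complex.exp_log hzs, hmul]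
  obtain ⟨n, hn⟩ := Complex.exp_eq_exp_iff_exists_int.1 hexp
  have h1 : |Complex.arg (1 + s / z)| < Real.pi / 2 :=
    Complex.abs_arg_lt_pi_div_two_iff.2 (Or.inl hre)
  have h2 : |Complex.arg (z + s) - Complex.arg z| ≤ Real.pi := by
    have a1 := Complex.neg_pi_lt_arg z
    have a2 := Complex.arg_le_pi z
    have b1 := Complex.neg_pi_lt_arg (z + s)
    have b2 := Complex.arg_le_pi (z + s)
    have him : (z + s).im = z.im := by simp
    rw [abs_le]
    rcases le_or_gt 0 z.im with h0 | h0
    · have := Complex.arg_nonneg_iff.2 h0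
      have := Complex.arg_nonneg_iff.2 (him.symm ▸ h0)
      constructor <;> linarith
    · have := Complex.arg_neg_iff.2 h0
      have := Complex.arg_neg_iff.2 (him.symm ▸ h0)
      constructor <;> linarith
  have him := congrArg Complex.im hn
  simp only [Complex.add_im, Complex.log_im, Complex.mul_im, Complex.mul_re, Complex.intCast_re,
    Complex.intCast_im, Complex.I_re, Complex.I_im, Complex.ofReal_re, Complex.ofReal_im,
    Complex.re_ofNat, Complex.im_ofNat] at him
  rw [abs_lt] at h1
  rw [abs_le] at h2
  have hpi := Real.pi_pos
  have hn1 : (n : ℝ) < 1 := by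
    by_contra hc
    push Not at hc
    nlinarith
  have hn2 : (-1 : ℝ) < n := by
    by_contra hc
    push Not at hc
    nlinarith
  have hn0 : n = 0 := by
    have : n < 1 := by exact_mod_cast hn1
    have : -1 < n := by exact_mod_cast hn2
    omega
  simpa [hn0] using hn

/-- The ratio `√(ω² + s²) / ω`, in a form that is visibly holomorphic for `‖ω‖ > s`. -/
noncomputable def sqRatio (s : ℝ) (ω : ℂ) : ℂ :=
  Complex.exp ((1 / 2 : ℂ) * (Complex.log (1 + Complex.I * s / ω) +
    Complex.log (1 + -(Complex.I * s / ω))))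

lemma norm_I_mul_div_lt {s : ℝ} (hs : 0 < s) {ω : ℂ} (hω : s < ‖ω‖) :
    ‖Complex.I * s / ω‖ < 1 := by
  rw [norm_div, norm_mul, Complex.norm_I, Complex.norm_real, Real.norm_of_nonneg hs.le, one_mul]
  exact (div_lt_one (hs.trans hω)).2 hω

lemma differentiableAt_sqRatio {s : ℝ} (hs : 0 < s) {ω : ℂ} (hω : s < ‖ω‖) :
    DifferentiableAt ℂ (sqRatio s) ω := by
  have h0 : ω ≠ 0 := norm_pos_iff.1 (hs.trans hω)
  have hw := norm_I_mul_div_lt hs hω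
  have h1 : (1 + Complex.I * s / ω) ∈ Complex.slitPlane :=
    Or.inl (one_add_re_pos_of_norm_lt hw)
  have h2 : (1 + -(Complex.I * s / ω)) ∈ Complex.slitPlane :=
    Or.inl (one_add_re_pos_of_norm_lt (by rwa [norm_neg]))
  unfold sqRatio
  fun_prop (disch := assumption)

lemma sqRatio_re_pos {s : ℝ} (hs : 0 < s) {ω : ℂ} (hω : s < ‖ω‖) : 0 < (sqRatio s ω).re := by
  have hw := norm_I_mul_div_lt hs hω
  have h1 := Complex.abs_arg_lt_pi_div_two_iff.2
    (Or.inl (one_add_re_pos_of_norm_lt hw))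
  have h2 := Complex.abs_arg_lt_pi_div_two_iff.2
    (Or.inl (one_add_re_pos_of_norm_lt (by rwa [norm_neg] : ‖-(Complex.I * s / ω)‖ < 1)))
  rw [abs_lt] at h1 h2
  have hhalf : (1 / 2 : ℂ) = ((1 / 2 : ℝ) : ℂ) := by push_cast; rfl
  rw [sqRatio, Complex.exp_re]
  refine mul_pos (Real.exp_pos _) (Real.cos_pos_of_mem_Ioo ?_)
  rw [hhalf, Complex.im_ofReal_mul, Complex.add_im, Complex.log_im, Complex.log_im]
  constructor <;> linarith

lemma sqRatio_sq {s : ℝ} (hs : 0 < s) {ω : ℂ} (hω : s < ‖ω‖) :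
    ω ^ 2 * sqRatio s ω ^ 2 = ω ^ 2 + (s : ℂ) ^ 2 := by
  have h0 : ω ≠ 0 := norm_pos_iff.1 (hs.trans hω)
  have hw := norm_I_mul_div_lt hs hω
  have h1 := one_add_re_pos_of_norm_lt hw
  have h2 := one_add_re_pos_of_norm_lt
    (by rwa [norm_neg] : ‖-(Complex.I * s / ω)‖ < 1)
  have e1 : 1 + Complex.I * s / ω ≠ 0 := fun h => by simp [h] at h1
  have e2 : 1 + -(Complex.I * s / ω) ≠ 0 := fun h => by rw [h] at h2; simp at h2
  rw [sqRatio, ← Complex.exp_nat_mul, Nat.cast_ofNat, ← mul_assoc,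
    show (2 : ℂ) * (1 / 2) = 1 by norm_num, one_mul, Complex.exp_add, Complex.exp_log e1,
    Complex.exp_log e2]
  field_simp
  linear_combination (-(s : ℂ) ^ 2) * Complex.I_sq

lemma sqBr_eq {a : ℝ} (ha0 : 0 < a) {ω : ℂ} (hω : cutRadius a < ‖ω‖) :
    sqBr a ω = ω * sqRatio (cutRadius a) ω := by
  have hs := cutRadius_pos ha0
  have h0 : ω ≠ 0 := norm_pos_iff.1 (hs.trans hω)
  have hz : -Complex.I * ω ≠ 0 := mul_ne_zero (neg_ne_zero.2 Complex.I_ne_zero) h0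
  have hnz : ‖-Complex.I * ω‖ = ‖ω‖ := by simp
  have l1 := log_add_ofReal (z := -Complex.I * ω) (s := cutRadius a)
    (by rwa [hnz, abs_of_pos hs])
  have l2 := log_add_ofReal (z := -Complex.I * ω) (s := -cutRadius a)
    (by rwa [hnz, abs_neg, abs_of_pos hs])
  have q1 : (cutRadius a : ℂ) / (-Complex.I * ω) = Complex.I * cutRadius a / ω := by
    field_simp
    rw [Complex.I_sq, mul_neg_one]
  have q2 : ((-cutRadius a : ℝ) : ℂ) / (-Complex.I * ω) = -(Complex.I * cutRadius a / ω) := by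
    rw [← q1]; push_cast; ring
  have t1 : -Complex.I * (ω + Complex.I * (cutRadius a : ℂ)) = -Complex.I * ω + cutRadius a := by
    linear_combination (-(cutRadius a : ℂ)) * Complex.I_sq
  have t2 : -Complex.I * (ω - Complex.I * (cutRadius a : ℂ)) =
      -Complex.I * ω + ((-cutRadius a : ℝ) : ℂ) := by
    push_cast
    linear_combination (cutRadius a : ℂ) * Complex.I_sq
  rw [q1] at l1
  rw [q2] at l2
  rw [sqBr, Lbr, Lbr, t1, t2, l1, l2, sqRatio]
  have key : ω = Complex.exp (Complex.log (-Complex.I * ω) + Complex.I * (Real.pi / 2)) := by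
    rw [Complex.exp_add, Complex.exp_log hz, mul_comm Complex.I (Real.pi / 2 : ℂ),
      Complex.exp_pi_div_two_mul_I]
    linear_combination ω * Complex.I_sq
  conv_rhs => lhs; rw [key]
  rw [← Complex.exp_add]
  congr 1
  ring

section Branch

variable {a : ℝ} {ω : ℂ}

lemma eventually_cutRadius_lt (hω : cutRadius a < ‖ω‖) : ∀ᶠ z in 𝓝 ω, cutRadius a < ‖z‖ :=
  (isOpen_lt continuous_const continuous_norm).mem_nhds hω

lemma differentiableAt_sqBr (ha0 : 0 < a) (hω : cutRadius a < ‖ω‖) :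
    DifferentiableAt ℂ (sqBr a) ω := by
  have h : DifferentiableAt ℂ (fun z => z * sqRatio (cutRadius a) z) ω :=
    differentiableAt_id.mul (differentiableAt_sqRatio (cutRadius_pos ha0) hω)
  exact h.congr_of_eventuallyEq
    ((eventually_cutRadius_lt hω).mono fun z hz => sqBr_eq ha0 hz)

lemma sqBr_sq (ha0 : 0 < a) (hω : cutRadius a < ‖ω‖) :
    sqBr a ω ^ 2 = ω ^ 2 + (cutRadius a : ℂ) ^ 2 := by
  rw [sqBr_eq ha0 hω, mul_pow, sqRatio_sq (cutRadius_pos ha0) hω]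

lemma sqBr_ne_zero (a : ℝ) (ω : ℂ) : sqBr a ω ≠ 0 := Complex.exp_ne_zero _

lemma hasDerivAt_sqBr (ha0 : 0 < a) (hω : cutRadius a < ‖ω‖) :
    HasDerivAt (sqBr a) (ω / sqBr a ω) ω := by
  have h := (differentiableAt_sqBr ha0 hω).hasDerivAt
  have h1 := h.pow 2
  have h2 : HasDerivAt (fun z => z ^ 2 + (cutRadius a : ℂ) ^ 2) (2 * ω) ω := by
    simpa using ((hasDerivAt_id ω).pow 2).add_const ((cutRadius a : ℂ) ^ 2)
  have h3 := h1.unique (h2.congr_of_eventuallyEq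
    ((eventually_cutRadius_lt hω).mono fun z hz => sqBr_sq ha0 hz))
  refine h.congr_deriv ?_
  rw [eq_div_iff (sqBr_ne_zero a ω)]
  simp only [Nat.cast_ofNat, Nat.add_one_sub_one, pow_one] at h3
  linear_combination (1 / 2 : ℂ) * h3

lemma Gbr_mul (ha0 : 0 < a) (hω : cutRadius a < ‖ω‖) :
    Gbr a ω * ((ω + sqBr a ω) / cutRadius a) = -1 := by
  have hs : (cutRadius a : ℂ) ≠ 0 := Complex.ofReal_ne_zero.2 (cutRadius_pos ha0).ne'
  have h : Gbr a ω = (ω - sqBr a ω) / cutRadius a := rfl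
  rw [h]
  field_simp
  linear_combination -sqBr_sq ha0 hω

lemma Gbr_ne_zero (ha0 : 0 < a) (hω : cutRadius a < ‖ω‖) : Gbr a ω ≠ 0 := fun h => by
  have := Gbr_mul ha0 hω
  simp [h] at this

lemma Gbr_sub_inv (ha0 : 0 < a) (hω : cutRadius a < ‖ω‖) :
    ω = cutRadius a / 2 * (Gbr a ω - (Gbr a ω)⁻¹) := by
  have hs : (cutRadius a : ℂ) ≠ 0 := Complex.ofReal_ne_zero.2 (cutRadius_pos ha0).ne'
  have hG : (Gbr a ω)⁻¹ = -((ω + sqBr a ω) / cutRadius a) :=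
    inv_eq_of_mul_eq_one_right <| by linear_combination -Gbr_mul ha0 hω
  have h : Gbr a ω = (ω - sqBr a ω) / cutRadius a := rfl
  rw [hG, h]
  field_simp
  ring

lemma hasDerivAt_Gbr (ha0 : 0 < a) (hω : cutRadius a < ‖ω‖) :
    HasDerivAt (Gbr a) (-(Gbr a ω / sqBr a ω)) ω := by
  have hs : (cutRadius a : ℂ) ≠ 0 := Complex.ofReal_ne_zero.2 (cutRadius_pos ha0).ne'
  have h := ((hasDerivAt_id ω).sub (hasDerivAt_sqBr ha0 hω)).div_const (cutRadius a : ℂ)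
  refine h.congr_deriv ?_
  have hS := sqBr_ne_zero a ω
  have h : Gbr a ω = (ω - sqBr a ω) / cutRadius a := rfl
  rw [h]
  field_simp
  ring

lemma hasDerivAt_Gbr_zpow (ha0 : 0 < a) (hω : cutRadius a < ‖ω‖) (m : ℤ) :
    HasDerivAt (fun z => Gbr a z ^ m) (-m * (Gbr a ω ^ m / sqBr a ω)) ω := by
  have hG := Gbr_ne_zero ha0 hω
  refine ((hasDerivAt_zpow m _ (Or.inl hG)).comp ω (hasDerivAt_Gbr ha0 hω)).congr_deriv ?_
  rw [zpow_sub_one₀ hG]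
  field_simp

/-- The function `G^m / √(ω² + 2c)`. -/
noncomputable def GDiv (a : ℝ) (m : ℤ) (ω : ℂ) : ℂ := Gbr a ω ^ m / sqBr a ω

lemma differentiableAt_GDiv (ha0 : 0 < a) (m : ℤ) (hω : cutRadius a < ‖ω‖) :
    DifferentiableAt ℂ (GDiv a m) ω :=
  (hasDerivAt_Gbr_zpow ha0 hω m).differentiableAt.div (differentiableAt_sqBr ha0 hω)
    (sqBr_ne_zero a ω)

lemma norm_of_mem_sphere_zero {r : ℝ} {z : ℂ} (hz : z ∈ sphere (0 : ℂ) r) : ‖z‖ = r := by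
  simpa using hz

lemma continuousOn_GDiv (ha0 : 0 < a) (m : ℤ) {r : ℝ} (hr : cutRadius a < r) :
    ContinuousOn (GDiv a m) (sphere 0 r) := fun z hz =>
  (differentiableAt_GDiv ha0 m
    (by rwa [norm_of_mem_sphere_zero hz])).continuousAt.continuousWithinAt

/-- Orthogonality: only the power `m = 0` of `G` contributes a residue against `dω / √(ω² + 2c)`. -/
lemma integral_GDiv (ha0 : 0 < a) {r : ℝ} (hr : cutRadius a < r) (m : ℤ) :
    (∮ ω in C(0, r), GDiv a m ω) = if m = 0 then 2 * Real.pi * Complex.I else 0 := by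
  have hs := cutRadius_pos ha0
  have hr0 : 0 < r := hs.trans hr
  split_ifs with hm
  · subst hm
    have hd : (∮ ω in C(0, r), (GDiv a 0 ω - (ω - 0)⁻¹)) = 0 := by
      refine circleIntegral.integral_eq_zero_of_hasDerivWithinAt hr0.le
        (f := fun z => Complex.log (1 + sqRatio (cutRadius a) z)) fun z hz => ?_
      have hz' : cutRadius a < ‖z‖ := by rwa [norm_of_mem_sphere_zero hz]
      have hz0 : z ≠ 0 := norm_pos_iff.1 (hs.trans hz')
      have hre := sqRatio_re_pos hs hz'
      have hslit : 1 + sqRatio (cutRadius a) z ∈ Complex.slitPlane := by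
        refine Or.inl ?_
        simp only [Complex.add_re, Complex.one_re]
        linarith
      have hq : HasDerivAt (sqRatio (cutRadius a))
          ((z / sqBr a z * z - sqBr a z * 1) / z ^ 2) z := by
        refine ((hasDerivAt_sqBr ha0 hz').div (hasDerivAt_id z) hz0).congr_of_eventuallyEq ?_
        filter_upwards [eventually_cutRadius_lt hz'] with w hw
        have hw0 : w ≠ 0 := norm_pos_iff.1 (hs.trans hw)
        simp [sqBr_eq ha0 hw, hw0]
      have hne := Complex.slitPlane_ne_zero hslit
      have hS := sqBr_ne_zero a z
      have hqe : sqRatio (cutRadius a) z = sqBr a z / z := by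
        rw [sqBr_eq ha0 hz']; field_simp
      refine ((hq.const_add 1).clog hslit).hasDerivWithinAt.congr_deriv ?_
      rw [hqe] at hne ⊢
      have hne' : z + sqBr a z ≠ 0 := fun h => hne (by field_simp; simpa using h)
      simp only [GDiv, zpow_zero, sub_zero]
      field_simp
      ring
    rw [circleIntegral.integral_sub ((continuousOn_GDiv ha0 0 hr).circleIntegrable hr0.le)
      (circleIntegrable_sub_inv_iff.2 (Or.inr (by simpa [abs_of_pos hr0] using hr0.ne))),
      circleIntegral.integral_sub_center_inv 0 hr0.ne'] at hd
    exact sub_eq_zero.1 hd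
  · refine circleIntegral.integral_eq_zero_of_hasDerivWithinAt hr0.le
      (f := fun z => (-m : ℂ)⁻¹ * Gbr a z ^ m) fun z hz => ?_
    have hm' : (m : ℂ) ≠ 0 := Int.cast_ne_zero.2 hm
    refine ((hasDerivAt_Gbr_zpow ha0 (by rwa [norm_of_mem_sphere_zero hz])
      m).const_mul _).hasDerivWithinAt.congr_deriv ?_
    rw [GDiv]
    field_simp

section CircleIntegral

lemma hasSum_circleIntegral_of_norm_le {R : ℝ} (hR : 0 ≤ R) {F : ℕ → ℂ → ℂ} {f : ℂ → ℂ}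
    {b : ℕ → ℝ} (hb : Summable b) (hF : ∀ n, ContinuousOn (F n) (sphere 0 R))
    (hle : ∀ n, ∀ z ∈ sphere (0 : ℂ) R, ‖F n z‖ ≤ b n)
    (hf : ∀ z ∈ sphere (0 : ℂ) R, HasSum (fun n => F n z) (f z)) :
    HasSum (fun n => ∮ z in C(0, R), F n z) (∮ z in C(0, R), f z) := by
  have hmem (θ : ℝ) : circleMap 0 R θ ∈ sphere (0 : ℂ) R := circleMap_mem_sphere 0 hR θ
  refine intervalIntegral.hasSum_integral_of_dominated_convergence (fun n _ => R * b n)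
    (fun n => ?_) (fun n => ?_) ?_ ?_ ?_
  · exact (((hF n).circleIntegrable hR).out).aestronglyMeasurable_restrict_uIoc
  · refine .of_forall fun θ _ => ?_
    rw [norm_smul, deriv_circleMap, norm_mul, Complex.norm_I, mul_one, norm_circleMap_zero,
      abs_of_nonneg hR]
    exact mul_le_mul_of_nonneg_left (hle n _ (hmem θ)) hR
  · exact .of_forall fun _ _ => hb.mul_left R
  · exact intervalIntegrable_const
  · exact .of_forall fun θ _ => (hf _ (hmem θ)).const_smul _

variable {r R q : ℝ} {f g φ ψ : ℂ → ℂ}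

lemma exists_norm_mul_integral_le (hR : 0 ≤ R)
    (hf : ContinuousOn f (sphere 0 r)) (hg : ContinuousOn g (sphere 0 R))
    (hq : ∀ z ∈ sphere (0 : ℂ) r, ∀ w ∈ sphere (0 : ℂ) R, ‖φ z * ψ w‖ ≤ q) :
    ∃ C : ℝ, ∀ n : ℕ, ∀ z ∈ sphere (0 : ℂ) r,
      ‖f z * φ z ^ n * ∮ w in C(0, R), g w * ψ w ^ n‖ ≤ C * q ^ n := by
  obtain ⟨M, hM⟩ := (isCompact_sphere (0 : ℂ) r).exists_bound_of_continuousOn hf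
  obtain ⟨N, hN⟩ := (isCompact_sphere (0 : ℂ) R).exists_bound_of_continuousOn hg
  refine ⟨2 * Real.pi * R * (M * N), fun n z hz => ?_⟩
  rw [← circleIntegral.integral_const_mul, mul_assoc _ _ (q ^ n)]
  refine circleIntegral.norm_integral_le_of_norm_le_const hR fun w hw => ?_
  have h : f z * φ z ^ n * (g w * ψ w ^ n) = f z * g w * (φ z * ψ w) ^ n := by ring
  rw [h, norm_mul, norm_mul, norm_pow]
  have := hM z hz
  have := hN w hw
  have := hq z hz w hw
  have : 0 ≤ M := (norm_nonneg _).trans (hM z hz)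
  have : 0 ≤ N := (norm_nonneg _).trans (hN w hw)
  gcongr

lemma hasSum_integral_div_one_sub (hR : 0 ≤ R) (hq1 : q < 1)
    (hg : ContinuousOn g (sphere 0 R)) (hψ : ContinuousOn ψ (sphere 0 R)) {x y : ℂ}
    (hq : ∀ w ∈ sphere (0 : ℂ) R, ‖y * ψ w‖ ≤ q) :
    HasSum (fun n : ℕ => x * y ^ n * ∮ w in C(0, R), g w * ψ w ^ n)
      (∮ w in C(0, R), x * g w / (1 - y * ψ w)) := by
  obtain ⟨N, hN⟩ := (isCompact_sphere (0 : ℂ) R).exists_bound_of_continuousOn hg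
  have hq0 : 0 ≤ q := (norm_nonneg _).trans (hq R (by simp [abs_of_nonneg hR]))
  simp_rw [← circleIntegral.integral_const_mul]
  refine hasSum_circleIntegral_of_norm_le hR (b := fun n => ‖x‖ * N * q ^ n)
    ((summable_geometric_of_lt_one hq0 hq1).mul_left _) (fun n => by fun_prop)
    (fun n w hw => ?_) fun w hw => ?_
  · have h : x * y ^ n * (g w * ψ w ^ n) = x * g w * (y * ψ w) ^ n := by ring
    rw [h, norm_mul, norm_mul, norm_pow]
    have := hN w hw
    have := hq w hw
    have : 0 ≤ N := (norm_nonneg _).trans (hN w hw)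
    gcongr
  · have h := (hasSum_geometric_of_norm_lt_one ((hq w hw).trans_lt hq1)).mul_left (x * g w)
    rw [← div_eq_mul_inv] at h
    exact h.congr_fun fun n => by ring

/-- Geometric expansion of a double circle integral with kernel `(1 - φ(z) ψ(w))⁻¹`. -/
lemma hasSum_integral_integral_div_one_sub (hr : 0 ≤ r) (hR : 0 ≤ R) (hq1 : q < 1)
    (hf : ContinuousOn f (sphere 0 r)) (hφ : ContinuousOn φ (sphere 0 r))
    (hg : ContinuousOn g (sphere 0 R)) (hψ : ContinuousOn ψ (sphere 0 R))
    (hq : ∀ z ∈ sphere (0 : ℂ) r, ∀ w ∈ sphere (0 : ℂ) R, ‖φ z * ψ w‖ ≤ q) :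
    HasSum (fun n : ℕ => (∮ z in C(0, r), f z * φ z ^ n) * ∮ w in C(0, R), g w * ψ w ^ n)
      (∮ z in C(0, r), ∮ w in C(0, R), f z * g w / (1 - φ z * ψ w)) := by
  have hq0 : 0 ≤ q := (norm_nonneg _).trans
    (hq r (by simp [abs_of_nonneg hr]) R (by simp [abs_of_nonneg hR]))
  obtain ⟨C, hC⟩ := exists_norm_mul_integral_le hR hf hg hq
  have h := hasSum_circleIntegral_of_norm_le hr
    ((summable_geometric_of_lt_one hq0 hq1).mul_left C) (fun n => by fun_prop) hC
    fun z hz => hasSum_integral_div_one_sub hR hq1 hg hψ (hq z hz)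
  convert h using 2 with n
  simp only [mul_comm _ (∮ w in C(0, R), g w * ψ w ^ _), circleIntegral.integral_const_mul]

lemma continuousOn_integral_div_one_sub (hr : 0 ≤ r) (hR : 0 ≤ R) (hq1 : q < 1)
    (hf : ContinuousOn f (sphere 0 r)) (hφ : ContinuousOn φ (sphere 0 r))
    (hg : ContinuousOn g (sphere 0 R)) (hψ : ContinuousOn ψ (sphere 0 R))
    (hq : ∀ z ∈ sphere (0 : ℂ) r, ∀ w ∈ sphere (0 : ℂ) R, ‖φ z * ψ w‖ ≤ q) :
    ContinuousOn (fun z => ∮ w in C(0, R), f z * g w / (1 - φ z * ψ w)) (sphere 0 r) := by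
  have hq0 : 0 ≤ q := (norm_nonneg _).trans
    (hq r (by simp [abs_of_nonneg hr]) R (by simp [abs_of_nonneg hR]))
  obtain ⟨C, hC⟩ := exists_norm_mul_integral_le hR hf hg hq
  exact (continuousOn_tsum (fun n => by fun_prop)
    ((summable_geometric_of_lt_one hq0 hq1).mul_left C) hC).congr
    fun z hz => (hasSum_integral_div_one_sub hR hq1 hg hψ (hq z hz)).tsum_eq.symm

lemma circleIntegral_eq_of_differentiableAt {s : ℝ} (hs : 0 < s) (hsr : s < r) (hsR : s < R)
    (hf : ∀ z : ℂ, s < ‖z‖ → DifferentiableAt ℂ f z) :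
    (∮ z in C(0, R), f z) = ∮ z in C(0, r), f z := by
  wlog hrR : r ≤ R generalizing r R
  · exact (this hsR hsr (le_of_not_ge hrR)).symm
  refine Complex.circleIntegral_eq_of_differentiable_on_annulus_off_countable (hs.trans hsr) hrR
    countable_empty (fun z hz => (hf z ?_).continuousAt.continuousWithinAt) fun z hz => hf z ?_
  · exact hsr.trans_le (by simpa using hz.2)
  · exact hsr.trans (by simpa using hz.1.2)

/-- Moving the circle of integration of a Cauchy-type integral across its pole. -/
lemma circleIntegral_sub_inv_mul_sub {s : ℝ} (hs : 0 < s) (hsr : s < r) {p : ℂ} (hrp : r < ‖p‖)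
    (hpR : ‖p‖ < R) (hf : ∀ z : ℂ, s < ‖z‖ → DifferentiableAt ℂ f z) :
    (∮ z in C(0, R), (z - p)⁻¹ * f z) - (∮ z in C(0, r), (z - p)⁻¹ * f z) =
      2 * Real.pi * Complex.I * f p := by
  have hr : 0 < r := hs.trans hsr
  have hR : 0 < R := hr.trans (hrp.trans hpR)
  have hopen : IsOpen {z : ℂ | s < ‖z‖} := isOpen_lt continuous_const continuous_norm
  have hd : DifferentiableOn ℂ (dslope f p) {z : ℂ | s < ‖z‖} :=
    (Complex.differentiableOn_dslope (hopen.mem_nhds (hsr.trans hrp))).2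
      fun z hz => (hf z hz).differentiableWithinAt
  have hd' : ∀ z : ℂ, s < ‖z‖ → DifferentiableAt ℂ (dslope f p) z :=
    fun z hz => hd.differentiableAt (hopen.mem_nhds hz)
  have split {ρ : ℝ} (hρ : s < ρ) (hne : ‖p‖ ≠ ρ) :
      (∮ z in C(0, ρ), (z - p)⁻¹ * f z) =
        (∮ z in C(0, ρ), dslope f p z) + (∮ z in C(0, ρ), (z - p)⁻¹) * f p := by
    have hρ0 : 0 < ρ := hs.trans hρ
    have hcd : ContinuousOn (dslope f p) (sphere 0 ρ) := fun z hz =>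
      (hd' z (by rwa [norm_of_mem_sphere_zero hz])).continuousAt.continuousWithinAt
    have hci : CircleIntegrable (fun z => f p * (z - p)⁻¹) 0 ρ :=
      (circleIntegrable_sub_inv_iff.2 (Or.inr (by simpa [abs_of_pos hρ0] using hne))).const_smul
        (a := f p)
    rw [mul_comm _ (f p), ← circleIntegral.integral_const_mul,
      ← circleIntegral.integral_add (hcd.circleIntegrable hρ0.le) hci]
    refine circleIntegral.integral_congr hρ0.le fun z hz => ?_
    have hzp : z ≠ p := fun h => hne (h ▸ norm_of_mem_sphere_zero hz)
    have hzp' := sub_ne_zero.2 hzp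
    simp only [dslope_of_ne f hzp, slope_def_field]
    field_simp
    ring
  rw [split (hsr.trans (hrp.trans hpR)) hpR.ne, split hsr hrp.ne',
    circleIntegral_eq_of_differentiableAt hs hsr (hsr.trans (hrp.trans hpR)) hd',
    circleIntegral.integral_sub_inv_of_mem_ball (by simpa using hpR),
    Complex.circleIntegral_eq_zero_of_differentiable_on_off_countable hr.le countable_empty
      (f := fun z => (z - p)⁻¹)]
  · ring
  · refine fun z hz => (ContinuousAt.inv₀ (by fun_prop) ?_).continuousWithinAt
    rintro h
    rw [sub_eq_zero.1 h] at hz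
    exact absurd hrp (not_lt.2 (by simpa using hz))
  · intro z hz
    refine DifferentiableAt.inv (by fun_prop) fun h => ?_
    have := hz.1
    rw [sub_eq_zero.1 h] at this
    exact absurd hrp (not_lt.2 (mem_ball_zero_iff.1 this).le)

end CircleIntegral

/-- In the variable `g = iu`, the moments of `G^l / √(ω² + 2c)` become integrals over `|u| = 1`. -/
lemma integral_GDiv_mul_pow (ha0 : 0 < a) {r : ℝ} (hr : cutRadius a < r) (n : ℕ) (l : ℤ) :
    Complex.I ^ (-l) * (∮ ω in C(0, r), GDiv a l ω * ω ^ n) =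
      ∮ u in C(0, 1), u ^ (l - 1) * (Complex.I * cutRadius a / 2 * (u + u⁻¹)) ^ n := by
  have hr0 : 0 < r := (cutRadius_pos ha0).trans hr
  induction n generalizing l with
  | zero =>
    simp only [pow_zero, mul_one, integral_GDiv ha0 hr]
    split_ifs with hl
    · subst hl
      have h := circleIntegral.integral_sub_center_inv 0 (one_ne_zero (α := ℝ))
      simp only [sub_zero] at h
      simp [h]
    · have h := circleIntegral.integral_sub_zpow_of_ne (n := l - 1) (by omega) 0 0 1
      simp only [sub_zero] at h
      simp [h]
  | succ n ih =>
    have hci (m : ℤ) (x : ℂ) : CircleIntegrable (fun ω => x * (GDiv a m ω * ω ^ n)) 0 r := by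
      have := continuousOn_GDiv ha0 m hr
      exact ContinuousOn.circleIntegrable hr0.le (by fun_prop)
    have hne : ∀ u ∈ sphere (0 : ℂ) 1, u ≠ 0 := fun u hu h => by simp [h] at hu
    have hcu (m : ℤ) (x : ℂ) : CircleIntegrable
        (fun u => x * (u ^ m * (Complex.I * cutRadius a / 2 * (u + u⁻¹)) ^ n)) 0 1 := by
      have h1 : ContinuousOn (fun u : ℂ => u ^ m) (sphere 0 1) :=
        fun u hu => (continuousAt_zpow₀ u m (Or.inl (hne u hu))).continuousWithinAt
      have h2 : ContinuousOn (fun u : ℂ => u⁻¹) (sphere 0 1) :=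
        continuousOn_id.inv₀ hne
      exact ContinuousOn.circleIntegrable zero_le_one (by fun_prop)
    have hL : (∮ ω in C(0, r), GDiv a l ω * ω ^ (n + 1)) =
        ∮ ω in C(0, r), ((cutRadius a / 2 : ℂ) * (GDiv a (l + 1) ω * ω ^ n) -
          (cutRadius a / 2 : ℂ) * (GDiv a (l - 1) ω * ω ^ n)) := by
      refine circleIntegral.integral_congr hr0.le fun ω hω => ?_
      have hω' : cutRadius a < ‖ω‖ := by rwa [norm_of_mem_sphere_zero hω]
      have hG := Gbr_ne_zero ha0 hω'
      simp only [GDiv, zpow_add_one₀ hG, zpow_sub_one₀ hG, pow_succ]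
      linear_combination (Gbr a ω ^ l / sqBr a ω * ω ^ n) * Gbr_sub_inv ha0 hω'
    have hR : (∮ u in C(0, 1), u ^ (l - 1) * (Complex.I * cutRadius a / 2 * (u + u⁻¹)) ^ (n + 1)) =
        ∮ u in C(0, 1), ((Complex.I * cutRadius a / 2) *
            (u ^ (l + 1 - 1) * (Complex.I * cutRadius a / 2 * (u + u⁻¹)) ^ n) +
          (Complex.I * cutRadius a / 2) *
            (u ^ (l - 1 - 1) * (Complex.I * cutRadius a / 2 * (u + u⁻¹)) ^ n)) := by
      refine circleIntegral.integral_congr zero_le_one fun u hu => ?_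
      have hu := hne u hu
      simp only [zpow_add_one₀ hu, zpow_sub_one₀ hu, pow_succ]
      field_simp
    rw [hL, hR, circleIntegral.integral_sub (hci _ _) (hci _ _),
      circleIntegral.integral_add (hcu _ _) (hcu _ _)]
    simp only [circleIntegral.integral_const_mul, ← ih]
    have e1 : Complex.I ^ (-(l + 1)) = Complex.I ^ (-l) * Complex.I⁻¹ := by
      rw [neg_add, zpow_add₀ Complex.I_ne_zero, zpow_neg_one]
    have e2 : Complex.I ^ (-(l - 1)) = Complex.I ^ (-l) * Complex.I := by
      rw [neg_sub, sub_eq_neg_add, zpow_add_one₀ Complex.I_ne_zero]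
    rw [e1, e2, Complex.inv_I]
    linear_combination (-Complex.I ^ (-l) * (cutRadius a / 2) *
      ((-∮ ω in C(0, r), GDiv a (l + 1) ω * ω ^ n) +
        ∮ ω in C(0, r), GDiv a (l - 1) ω * ω ^ n)) * Complex.I_sq

/-- The solid-phase double integral over circles of radii `r` and `R`. -/
noncomputable def couplingIntegral (a r R : ℝ) (k l : ℤ) : ℂ :=
  ∮ z in C(0, r), ∮ w in C(0, R), GDiv a l z * GDiv a k w / (1 - z * w)

lemma hasSum_couplingIntegral (ha0 : 0 < a) {r : ℝ} (hr : cutRadius a < r) (hr1 : r < 1)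
    (k l : ℤ) :
    HasSum (fun n : ℕ => (∮ z in C(0, r), GDiv a l z * z ^ n) *
      ∮ w in C(0, r), GDiv a k w * w ^ n) (couplingIntegral a r r k l) := by
  have hr0 : 0 ≤ r := ((cutRadius_pos ha0).trans hr).le
  refine hasSum_integral_integral_div_one_sub hr0 hr0 (q := r * r) (by nlinarith)
    (continuousOn_GDiv ha0 l hr) continuousOn_id (continuousOn_GDiv ha0 k hr) continuousOn_id
    fun z hz w hw => ?_
  simp [norm_of_mem_sphere_zero hz, norm_of_mem_sphere_zero hw]

lemma EE_eq (ha0 : 0 < a) (ha1 : a < 1) {r : ℝ} (hr : cutRadius a < r) (hr1 : r < 1) (k l : ℤ) :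
    EE a k l = Complex.I ^ (-k - l) * (2 * (1 + (a : ℂ) ^ 2))⁻¹ *
      ((2 * (Real.pi : ℂ) * Complex.I) ^ 2)⁻¹ * couplingIntegral a r r k l := by
  have hs := cutRadius_pos ha0
  have hs1 := cutRadius_lt_one ha1
  have hne : ∀ u ∈ sphere (0 : ℂ) 1, u ≠ 0 := fun u hu h => by simp [h] at hu
  have h1 (m : ℤ) : ContinuousOn (fun u : ℂ => u ^ m) (sphere 0 1) :=
    fun u hu => (continuousAt_zpow₀ u m (Or.inl (hne u hu))).continuousWithinAt
  have h2 : ContinuousOn (fun u : ℂ => u⁻¹) (sphere 0 1) := continuousOn_id.inv₀ hne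
  have h3 : ContinuousOn (fun u : ℂ => Complex.I * cutRadius a / 2 * (u + u⁻¹)) (sphere 0 1) := by
    fun_prop
  have hb : ∀ u ∈ sphere (0 : ℂ) 1,
      ‖Complex.I * cutRadius a / 2 * (u + u⁻¹)‖ ≤ cutRadius a := fun u hu => by
    have hu1 := norm_of_mem_sphere_zero hu
    have : ‖u + u⁻¹‖ ≤ 2 := (norm_add_le _ _).trans (by rw [norm_inv, hu1]; norm_num)
    rw [norm_mul, norm_div, norm_mul, Complex.norm_I, Complex.norm_real,
      Real.norm_of_nonneg hs.le, Complex.norm_two]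
    nlinarith
  have hsum := hasSum_integral_integral_div_one_sub zero_le_one zero_le_one
    (q := cutRadius a * cutRadius a) (by nlinarith) (h1 (l - 1)) h3 (h1 (k - 1)) h3
    fun u hu v hv => by
      rw [norm_mul]
      exact mul_le_mul (hb u hu) (hb v hv) (norm_nonneg _) hs.le
  simp_rw [← integral_GDiv_mul_pow ha0 hr] at hsum
  have hcoup := (hasSum_couplingIntegral ha0 hr hr1 k l).mul_left (Complex.I ^ (-k - l))
  have hpow : Complex.I ^ (-k - l) = Complex.I ^ (-l) * Complex.I ^ (-k) := by
    rw [← zpow_add₀ Complex.I_ne_zero]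
    congr 1
    ring
  have heq := hsum.unique (hcoup.congr_fun fun n => by rw [hpow]; ring)
  have hK : (1 + (a : ℂ) ^ 2) ≠ 0 := by
    exact_mod_cast (by positivity : (1 + a ^ 2 : ℝ) ≠ 0)
  have hEE : (∮ u in C(0, 1), ∮ v in C(0, 1), u ^ l * v ^ k / (ccheck a u v * u * v)) =
      (2 * (1 + (a : ℂ) ^ 2))⁻¹ * ∮ u in C(0, 1), ∮ v in C(0, 1), u ^ (l - 1) * v ^ (k - 1) /
        (1 - Complex.I * cutRadius a / 2 * (u + u⁻¹) *
          (Complex.I * cutRadius a / 2 * (v + v⁻¹))) := by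
    simp_rw [← circleIntegral.integral_const_mul]
    refine circleIntegral.integral_congr zero_le_one fun u hu =>
      circleIntegral.integral_congr zero_le_one fun v hv => ?_
    have hu' := hne u hu
    have hv' := hne v hv
    have hc : ccheck a u v = 2 * (1 + (a : ℂ) ^ 2) * (1 - Complex.I * cutRadius a / 2 * (u + u⁻¹) *
        (Complex.I * cutRadius a / 2 * (v + v⁻¹))) := by
      have hsq : (1 + (a : ℂ) ^ 2) * (cutRadius a : ℂ) ^ 2 = 2 * a := by
        rw [cutRadius_sq ha0]
        field_simp
      rw [ccheck]
      linear_combination (-(1 / 2) * (u + u⁻¹) * (v + v⁻¹)) * hsq +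
        (1 / 2 * (1 + (a : ℂ) ^ 2) * (cutRadius a : ℂ) ^ 2 * (u + u⁻¹) * (v + v⁻¹)) * Complex.I_sq
    simp only [hc, zpow_sub_one₀ hu', zpow_sub_one₀ hv', div_eq_mul_inv, mul_inv]
    ring
  rw [EE, hEE, heq]
  ring

lemma mul_ne_one_of_mem_sphere {r R : ℝ} (h : r * R ≠ 1) {z w : ℂ} (hz : z ∈ sphere (0 : ℂ) r)
    (hw : w ∈ sphere (0 : ℂ) R) : z * w ≠ 1 := fun hzw => h <| by
  rw [← norm_of_mem_sphere_zero hz, ← norm_of_mem_sphere_zero hw, ← norm_mul, hzw, norm_one]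

lemma mul_div_one_sub_mul {z w x y : ℂ} (hz : z ≠ 0) (hw : w ≠ 0) (hzw : z * w ≠ 1) :
    x * y / (1 - z * w) = -(x * z⁻¹) * (y * w⁻¹) / (1 - z⁻¹ * w⁻¹) := by
  have d1 : 1 - z * w ≠ 0 := sub_ne_zero.2 hzw.symm
  have d2 : z * w - 1 ≠ 0 := sub_ne_zero.2 hzw
  have d3 : 1 - z⁻¹ * w⁻¹ = (z * w - 1) / (z * w) := by field_simp
  rw [d3]
  field_simp
  ring

/-- For `rR > 1` the coupling integral does not depend on the radius of the first circle. -/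
lemma couplingIntegral_eq (ha0 : 0 < a) {r r' R : ℝ} (hr : cutRadius a < r)
    (hr' : cutRadius a < r') (hR : cutRadius a < R) (hrR : 1 < r * R) (hr'R : 1 < r' * R)
    (k l : ℤ) : couplingIntegral a r R k l = couplingIntegral a r' R k l := by
  have hs := cutRadius_pos ha0
  have hR0 := hs.trans hR
  have expand {ρ : ℝ} (hρ : cutRadius a < ρ) (hρR : 1 < ρ * R) :
      HasSum (fun n : ℕ => (∮ z in C(0, ρ), -(GDiv a l z * z⁻¹) * z⁻¹ ^ n) *
        ∮ w in C(0, R), GDiv a k w * w⁻¹ * w⁻¹ ^ n) (couplingIntegral a ρ R k l) := by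
    have hρ0 := hs.trans hρ
    have hne {t : ℝ} (ht : 0 < t) : ∀ u ∈ sphere (0 : ℂ) t, u ≠ 0 := fun u hu h => by
      simp [h, ht.ne] at hu
    have hinv {t : ℝ} (ht : 0 < t) : ContinuousOn (fun u : ℂ => u⁻¹) (sphere 0 t) :=
      continuousOn_id.inv₀ (hne ht)
    have h := hasSum_integral_integral_div_one_sub hρ0.le hR0.le (q := (ρ * R)⁻¹)
      (inv_lt_one_of_one_lt₀ hρR) ((continuousOn_GDiv ha0 l hρ).mul (hinv hρ0)).neg (hinv hρ0)
      ((continuousOn_GDiv ha0 k hR).mul (hinv hR0)) (hinv hR0) fun z hz w hw => by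
        rw [norm_mul, norm_inv, norm_inv, norm_of_mem_sphere_zero hz,
          norm_of_mem_sphere_zero hw, mul_inv]
    refine Eq.subst (motive := fun x => HasSum _ x) (Eq.symm ?_) h
    refine circleIntegral.integral_congr hρ0.le fun z hz =>
      circleIntegral.integral_congr hR0.le fun w hw => ?_
    have hz0 := hne hρ0 z hz
    have hw0 := hne hR0 w hw
    exact mul_div_one_sub_mul hz0 hw0 (mul_ne_one_of_mem_sphere hρR.ne' hz hw)
  refine (expand hr hrR).unique ((expand hr' hr'R).congr_fun fun n => ?_)
  congr 1
  refine circleIntegral_eq_of_differentiableAt hs hr' hr fun z hz => ?_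
  have := differentiableAt_GDiv ha0 l hz
  have : z ≠ 0 := norm_pos_iff.1 (hs.trans hz)
  fun_prop (disch := assumption)

/-- Moving the second circle across the pole `zw = 1`. -/
lemma couplingIntegral_sub (ha0 : 0 < a) {r R : ℝ} (hr : cutRadius a < r) (hr1 : r < 1)
    (hR : 1 < R) (hrR : 1 < r * R) (k l : ℤ) :
    couplingIntegral a r r k l = couplingIntegral a r R k l +
      2 * Real.pi * Complex.I * ∮ z in C(0, r), GDiv a l z * GDiv a k z⁻¹ / z := by
  have hs := cutRadius_pos ha0
  have hr0 := hs.trans hr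
  have hR0 : 0 < R := one_pos.trans hR
  have hsR : cutRadius a < R := hr.trans (hr1.trans hR)
  have hne : ∀ z ∈ sphere (0 : ℂ) r, z ≠ 0 := fun z hz h => by simp [h, hr0.ne] at hz
  have hneR : ∀ w ∈ sphere (0 : ℂ) R, w ≠ 0 := fun w hw h => by simp [h, hR0.ne] at hw
  have hinv : ContinuousOn (fun z : ℂ => z⁻¹) (sphere 0 r) := continuousOn_id.inv₀ hne
  have hinvR : ContinuousOn (fun z : ℂ => z⁻¹) (sphere 0 R) := continuousOn_id.inv₀ hneR
  have hl := continuousOn_GDiv ha0 l hr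
  have hinv_norm : ∀ z ∈ sphere (0 : ℂ) r, 1 < ‖z⁻¹‖ := fun z hz => by
    rw [norm_inv, norm_of_mem_sphere_zero hz]
    exact (one_lt_inv₀ hr0).2 hr1
  have hcoup : ContinuousOn
      (fun z => ∮ w in C(0, R), GDiv a l z * GDiv a k w / (1 - z * w)) (sphere 0 r) := by
    have h := continuousOn_integral_div_one_sub hr0.le hR0.le (q := (r * R)⁻¹)
      (inv_lt_one_of_one_lt₀ hrR) (hl.mul hinv).neg hinv
      ((continuousOn_GDiv ha0 k hsR).mul hinvR) hinvR fun z hz w hw => by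
        rw [norm_mul, norm_inv, norm_inv, norm_of_mem_sphere_zero hz,
          norm_of_mem_sphere_zero hw, mul_inv]
    exact h.congr fun z hz => circleIntegral.integral_congr hR0.le fun w hw =>
      mul_div_one_sub_mul (hne z hz) (hneR w hw) (mul_ne_one_of_mem_sphere hrR.ne' hz hw)
  have hres : ContinuousOn (fun z => GDiv a l z * GDiv a k z⁻¹ / z) (sphere 0 r) := by
    refine (hl.mul fun z hz => ?_).div continuousOn_id hne
    exact (differentiableAt_GDiv ha0 k (hr.trans (hr1.trans (hinv_norm z hz)))).continuousAt
      |>.comp_continuousWithinAt (hinv z hz)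
  rw [couplingIntegral, couplingIntegral, ← circleIntegral.integral_const_mul,
    ← circleIntegral.integral_add (hcoup.circleIntegrable hr0.le)
      (ContinuousOn.circleIntegrable hr0.le (by fun_prop))]
  refine circleIntegral.integral_congr hr0.le fun z hz => ?_
  have hz0 := hne z hz
  have pull (ρ : ℝ) : (∮ w in C(0, ρ), GDiv a l z * GDiv a k w / (1 - z * w)) =
      -(GDiv a l z * z⁻¹) * ∮ w in C(0, ρ), (w - z⁻¹)⁻¹ * GDiv a k w := by
    rw [← circleIntegral.integral_const_mul]
    congr 1
    funext w
    have h : 1 - z * w = -z * (w - z⁻¹) := by field_simp; ring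
    rw [h, div_eq_mul_inv, mul_inv, inv_neg]
    ring
  have hpR : ‖z⁻¹‖ < R := by
    rw [norm_inv, norm_of_mem_sphere_zero hz]
    exact inv_lt_of_inv_lt₀ hR0 ((inv_lt_iff_one_lt_mul₀ hR0).2 hrR)
  have hc := circleIntegral_sub_inv_mul_sub hs hr (hr1.trans (hinv_norm z hz)) hpR
    fun w hw => differentiableAt_GDiv ha0 k hw
  simp only [pull]
  rw [div_eq_mul_inv]
  linear_combination (GDiv a l z * z⁻¹) * hc

lemma Ctilde_eq (ha0 : 0 < a) (ha1 : a < 1) {r : ℝ} (hr : cutRadius a < r) (hr1 : r < 1)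
    (k l : ℤ) :
    Ctilde a k l = Complex.I ^ (-k - l) * (2 * (1 + (a : ℂ) ^ 2))⁻¹ *
      (2 * (Real.pi : ℂ) * Complex.I)⁻¹ * ∮ z in C(0, r), GDiv a l z * GDiv a k z⁻¹ / z := by
  have hs := cutRadius_pos ha0
  have hs1 := cutRadius_lt_one ha1
  have hr0 := hs.trans hr
  have hd : ∀ z : ℂ, cutRadius a < ‖z‖ → ‖z‖ ≤ 1 →
      DifferentiableAt ℂ (fun z => GDiv a l z * GDiv a k z⁻¹ / z) z := fun z hz hz1 => by
    have hz0 : z ≠ 0 := norm_pos_iff.1 (hs.trans hz)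
    have hzi : cutRadius a < ‖z⁻¹‖ := by
      rw [norm_inv]
      exact hs1.trans_le ((one_le_inv₀ (norm_pos_iff.2 hz0)).2 hz1)
    exact ((differentiableAt_GDiv ha0 l hz).mul
      ((differentiableAt_GDiv ha0 k hzi).comp z (differentiableAt_inv hz0))).div
      differentiableAt_id hz0
  rw [Ctilde, ← Complex.circleIntegral_eq_of_differentiable_on_annulus_off_countable hr0 hr1.le
    countable_empty (fun z hz => (hd z (hr.trans_le (by simpa using hz.2))
      (by simpa using hz.1)).continuousAt.continuousWithinAt)
    fun z hz => hd z (hr.trans (by simpa using hz.1.2)) (mem_ball_zero_iff.1 hz.1.1).le]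
  congr 2
  funext z
  simp only [GDiv, div_eq_mul_inv, mul_inv]
  ring

end Branch

/-- For all integers `k, ℓ` and every real `R > 1`, one has the
decomposition `E_{k,ℓ} = C̃(k,ℓ) + S̃_R(k,ℓ)`. -/
theorem statement17 (a : ℝ) (ha0 : 0 < a) (ha1 : a < 1) (k l : ℤ) (R : ℝ) (hR : 1 < R) :
    EE a k l = Ctilde a k l + Stilde a R k l := by
  have hs := cutRadius_pos ha0
  have hs1 := cutRadius_lt_one ha1
  have hR0 : 0 < R := one_pos.trans hR
  obtain ⟨r, hr, hr1⟩ := exists_between (max_lt hs1 (inv_lt_one_of_one_lt₀ hR))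
  obtain ⟨hsr, hRr⟩ := max_lt_iff.1 hr
  have hrR : 1 < r * R := (inv_lt_iff_one_lt_mul₀ hR0).1 hRr
  have hsR : cutRadius a < R := hs1.trans hR
  have hS : Stilde a R k l = Complex.I ^ (-k - l) * (2 * (1 + (a : ℂ) ^ 2))⁻¹ *
      ((2 * (Real.pi : ℂ) * Complex.I) ^ 2)⁻¹ * couplingIntegral a R R k l := by
    rw [Stilde, couplingIntegral]
    simp only [GDiv, div_eq_mul_inv, mul_inv]
    congr! 5
    ring
  rw [EE_eq ha0 ha1 hsr hr1, Ctilde_eq ha0 ha1 hsr hr1, hS, couplingIntegral_sub ha0 hsr hr1 hR hrR,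
    couplingIntegral_eq ha0 hsr hsR hsR hrR (by nlinarith)]
  have hpi := Complex.two_pi_I_ne_zero
  field_simp
  ring
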